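/- The ideal F_n of S_n is nonzero and is contained in every nonzero two-sided ideal of S_n (so F_n is the smallest nonzero ideal of S_n); moreover F_n² = F_n, and F_n equals the socle (the sum of all simple submodules) of S_n as a left S_n-module and also equals the socle of S_n as a right S_n-module. -/

import Mathlib

set_option synthInstance.maxHeartbeats 1000000
set_option maxHeartbeats 1000000

open MvPolynomial

noncomputable section

/-- The polynomial algebra `P_n = K[x_1, …, x_n]`. -/
abbrev PolyAlg (K : Type u) [Field K] (n : ℕ) := MvPolynomial (Fin n) K

/-- `X_i` : multiplication by the variable `x_i`, as a `K`-linear endomorphism of `P_n`. -/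
def Xop (K : Type u) [Field K] (n : ℕ) (i : Fin n) : Module.End K (PolyAlg K n) :=
  LinearMap.mulLeft K (X i)

/-- `Y_i` : the left inverse of `X_i`, sending a monomial `x^α` to `x^{α - e_i}` if `α i ≥ 1`
and to `0` otherwise. -/
def Yop (K : Type u) [Field K] (n : ℕ) (i : Fin n) : Module.End K (PolyAlg K n) :=
  (basisMonomials (Fin n) K).constr K fun α =>
    if α i = 0 then 0 else monomial (α - Finsupp.single i 1) (1 : K)

/-- The algebra `S_n` of one-sided inverses of `P_n` : the subalgebra of `End_K(P_n)`
generated by `X_1, …, X_n, Y_1, …, Y_n`. -/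
def SnAlg (K : Type u) [Field K] (n : ℕ) : Subalgebra K (Module.End K (PolyAlg K n)) :=
  Algebra.adjoin K (Set.range (Xop K n) ∪ Set.range (Yop K n))

/-- `x_i` as an element of `S_n`. -/
def xS (K : Type u) [Field K] (n : ℕ) (i : Fin n) : SnAlg K n :=
  ⟨Xop K n i, Algebra.subset_adjoin (Set.mem_union_left _ ⟨i, rfl⟩)⟩

/-- `y_i` as an element of `S_n`. -/
def yS (K : Type u) [Field K] (n : ℕ) (i : Fin n) : SnAlg K n :=
  ⟨Yop K n i, Algebra.subset_adjoin (Set.mem_union_right _ ⟨i, rfl⟩)⟩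

/-- The product `I*J` of two two-sided ideals: the two-sided ideal generated by all products
`a * b` with `a ∈ I`, `b ∈ J`. -/
def tsiMul {R : Type*} [Ring R] (I J : TwoSidedIdeal R) : TwoSidedIdeal R :=
  TwoSidedIdeal.span {x | ∃ a ∈ I, ∃ b ∈ J, x = a * b}

/-- A two-sided ideal `P` of a ring is prime if it is proper and for all two-sided ideals
`I`, `J`, `I*J ⊆ P` implies `I ⊆ P` or `J ⊆ P`. -/
def tsiPrime {R : Type*} [Ring R] (P : TwoSidedIdeal R) : Prop :=
  P ≠ ⊤ ∧ ∀ I J : TwoSidedIdeal R, tsiMul I J ≤ P → I ≤ P ∨ J ≤ P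

/-- The ideal `F_n` of `S_n`, generated by the product `(1-x_1y_1)(1-x_2y_2)⋯(1-x_ny_n)`. -/
def FIdeal (K : Type u) [Field K] (n : ℕ) : TwoSidedIdeal (SnAlg K n) :=
  TwoSidedIdeal.span {(List.ofFn fun i => 1 - xS K n i * yS K n i).prod}

section RingSocle

variable {R : Type*} [Ring R] {e : R}

theorem TwoSidedIdeal.mem_of_forall_sandwich (h : ∀ a : R, a ≠ 0 → ∃ s r, e * s * a * r * e = e)
    {I : TwoSidedIdeal R} (hI : I ≠ ⊥) : e ∈ I := by
  obtain ⟨a, haI, ha⟩ : ∃ a ∈ I, a ≠ 0 := by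
    by_contra! hc
    exact hI (le_bot_iff.mp fun x hx => (TwoSidedIdeal.mem_bot R).mpr (hc x hx))
  obtain ⟨s, r, hsr⟩ := h a ha
  rw [← hsr]
  exact I.mul_mem_right _ _ (I.mul_mem_right _ _ (I.mul_mem_left _ _ haI))

theorem tsiMul_span_idempotent (he : e * e = e) :
    tsiMul (TwoSidedIdeal.span {e}) (TwoSidedIdeal.span {e}) = TwoSidedIdeal.span {e} := by
  apply le_antisymm
  · refine TwoSidedIdeal.span_le.mpr ?_
    rintro x ⟨a, ha, b, -, rfl⟩
    exact TwoSidedIdeal.mul_mem_right _ _ _ ha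
  · have hmem : e ∈ TwoSidedIdeal.span {e} := TwoSidedIdeal.subset_span rfl
    refine TwoSidedIdeal.span_le.mpr (Set.singleton_subset_iff.mpr ?_)
    exact TwoSidedIdeal.subset_span ⟨e, hmem, e, hmem, he.symm⟩

theorem isAtom_span_mul_of_sandwich (h : ∀ a : R, a ≠ 0 → ∃ s r, e * s * a * r * e = e)
    (hc : ∀ a b : R, e * a * e * (e * b * e) = e * b * e * (e * a * e)) (he : e * e = e)
    {r : R} (hr : e * r ≠ 0) : IsAtom (Submodule.span R {e * r}) := by
  rw [isAtom_iff_le_of_ge]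
  refine ⟨fun hb => hr (Submodule.span_singleton_eq_bot.mp hb), fun N hN hle => ?_⟩
  obtain ⟨x, hxN, hx⟩ := N.exists_mem_ne_zero_of_ne_bot hN
  obtain ⟨a, rfl⟩ := Submodule.mem_span_singleton.mp (hle hxN)
  simp only [smul_eq_mul] at hxN hx
  have hae : a * e ≠ 0 := fun h0 => hx (by rw [← mul_assoc, h0, zero_mul])
  obtain ⟨s, t, hst⟩ := h (a * e) hae
  have key : e * t * e * s * a * e = e := by
    calc e * t * e * s * a * e = e * t * (e * e) * s * a * e := by rw [he]
      _ = e * t * e * (e * (s * a) * e) := by noncomm_ring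
      _ = e * (s * a) * e * (e * t * e) := hc _ _
      _ = e * s * a * (e * e) * t * e := by noncomm_ring
      _ = e * s * (a * e) * t * e := by rw [he]; noncomm_ring
      _ = e := hst
  rw [Submodule.span_singleton_le_iff_mem]
  have hmem := N.smul_mem (e * t * e * s) hxN
  rwa [smul_eq_mul, ← mul_assoc, ← mul_assoc, key] at hmem

theorem isAtom_span_op_mul_of_sandwich (h : ∀ a : R, a ≠ 0 → ∃ s r, e * s * a * r * e = e)
    (hc : ∀ a b : R, e * a * e * (e * b * e) = e * b * e * (e * a * e)) (he : e * e = e)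
    {r : R} (hr : r * e ≠ 0) : IsAtom (Submodule.span Rᵐᵒᵖ {r * e}) := by
  rw [isAtom_iff_le_of_ge]
  refine ⟨fun hb => hr (Submodule.span_singleton_eq_bot.mp hb), fun N hN hle => ?_⟩
  obtain ⟨x, hxN, hx⟩ := N.exists_mem_ne_zero_of_ne_bot hN
  obtain ⟨a, rfl⟩ := Submodule.mem_span_singleton.mp (hle hxN)
  obtain ⟨a, rfl⟩ := MulOpposite.op_surjective a
  simp only [MulOpposite.smul_eq_mul_unop, MulOpposite.unop_op] at hxN hx
  have hae : e * a ≠ 0 := fun h0 => hx (by rw [mul_assoc, h0, mul_zero])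
  obtain ⟨s, t, hst⟩ := h (e * a) hae
  have key : e * (a * (t * (e * (s * e)))) = e := by
    calc e * (a * (t * (e * (s * e)))) = e * (a * (t * ((e * e) * (s * e)))) := by rw [he]
      _ = e * (a * t) * e * (e * s * e) := by noncomm_ring
      _ = e * s * e * (e * (a * t) * e) := hc _ _
      _ = e * s * (e * e) * a * t * e := by noncomm_ring
      _ = e * s * (e * a) * t * e := by rw [he]; noncomm_ring
      _ = e := hst
  rw [Submodule.span_singleton_le_iff_mem]
  have hmem := N.smul_mem (MulOpposite.op (t * (e * (s * e)))) hxN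
  rwa [MulOpposite.smul_eq_mul_unop, MulOpposite.unop_op, mul_assoc, mul_assoc, key] at hmem

theorem TwoSidedIdeal.coe_span_singleton_subset_addSubgroup {S : AddSubgroup R}
    (hS : ∀ a b : R, a * e * b ∈ S) : (TwoSidedIdeal.span {e} : Set R) ⊆ S := by
  intro x hx
  refine (AddSubgroup.closure_le S).mpr ?_ (mem_span_iff_mem_addSubgroup_closure.mp hx)
  rintro _ ⟨_, ⟨a, -, _, rfl, rfl⟩, b, -, rfl⟩
  exact hS a b

theorem TwoSidedIdeal.coe_span_singleton_eq_left_socle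
    (h : ∀ a : R, a ≠ 0 → ∃ s r, e * s * a * r * e = e)
    (hc : ∀ a b : R, e * a * e * (e * b * e) = e * b * e * (e * a * e)) (he : e * e = e)
    (he0 : e ≠ 0) :
    (TwoSidedIdeal.span {e} : Set R) =
      ((sSup {N : Submodule R R | IsAtom N} : Submodule R R) : Set R) := by
  have hmem : e ∈ TwoSidedIdeal.span {e} := TwoSidedIdeal.subset_span rfl
  apply Set.Subset.antisymm
  · refine TwoSidedIdeal.coe_span_singleton_subset_addSubgroup
      (S := (sSup {N : Submodule R R | IsAtom N}).toAddSubgroup) fun a b => ?_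
    rw [Submodule.mem_toAddSubgroup, mul_assoc]
    by_cases hb : e * b = 0
    · rw [hb, mul_zero]
      exact Submodule.zero_mem _
    · exact Submodule.smul_mem _ a (le_sSup
        (show _ ∈ {N : Submodule R R | IsAtom N} from isAtom_span_mul_of_sandwich h hc he hb)
        (Submodule.mem_span_singleton_self _))
  · let F : Submodule R R := TwoSidedIdeal.asIdeal (TwoSidedIdeal.span {e})
    have hF : sSup {N : Submodule R R | IsAtom N} ≤ F := by
      refine sSup_le fun N hN => ?_
      obtain ⟨a, haN, ha⟩ := N.exists_mem_ne_zero_of_ne_bot hN.1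
      obtain ⟨s, r, hsr⟩ := h a ha
      refine inf_eq_left.mp ((hN.le_iff.mp (inf_le_left : N ⊓ F ≤ N)).resolve_left fun hb => ?_)
      have hx : e * s * a ∈ N ⊓ F := ⟨N.smul_mem _ haN, TwoSidedIdeal.mem_asIdeal.mpr
        (TwoSidedIdeal.mul_mem_right _ _ _ (TwoSidedIdeal.mul_mem_right _ _ _ hmem))⟩
      rw [hb, Submodule.mem_bot] at hx
      rw [hx, zero_mul, zero_mul] at hsr
      exact he0 hsr.symm
    exact fun x hx => TwoSidedIdeal.mem_asIdeal.mp (hF hx)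

theorem TwoSidedIdeal.coe_span_singleton_eq_right_socle
    (h : ∀ a : R, a ≠ 0 → ∃ s r, e * s * a * r * e = e)
    (hc : ∀ a b : R, e * a * e * (e * b * e) = e * b * e * (e * a * e)) (he : e * e = e)
    (he0 : e ≠ 0) :
    (TwoSidedIdeal.span {e} : Set R) =
      ((sSup {N : Submodule Rᵐᵒᵖ R | IsAtom N} : Submodule Rᵐᵒᵖ R) : Set R) := by
  have hmem : e ∈ TwoSidedIdeal.span {e} := TwoSidedIdeal.subset_span rfl
  apply Set.Subset.antisymm
  · refine TwoSidedIdeal.coe_span_singleton_subset_addSubgroup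
      (S := (sSup {N : Submodule Rᵐᵒᵖ R | IsAtom N}).toAddSubgroup) fun a b => ?_
    rw [Submodule.mem_toAddSubgroup]
    by_cases ha : a * e = 0
    · rw [ha, zero_mul]
      exact Submodule.zero_mem _
    · exact Submodule.smul_mem _ (MulOpposite.op b) (le_sSup
        (show _ ∈ {N : Submodule Rᵐᵒᵖ R | IsAtom N} from
          isAtom_span_op_mul_of_sandwich h hc he ha)
        (Submodule.mem_span_singleton_self _))
  · let F : Submodule Rᵐᵒᵖ R :=
      { carrier := (TwoSidedIdeal.span {e} : Set R)
        add_mem' := (TwoSidedIdeal.span {e}).add_mem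
        zero_mem' := (TwoSidedIdeal.span {e}).zero_mem
        smul_mem' := fun r _ hx => (TwoSidedIdeal.span {e}).mul_mem_right _ r.unop hx }
    have hF : sSup {N : Submodule Rᵐᵒᵖ R | IsAtom N} ≤ F := by
      refine sSup_le fun N hN => ?_
      obtain ⟨a, haN, ha⟩ := N.exists_mem_ne_zero_of_ne_bot hN.1
      obtain ⟨s, r, hsr⟩ := h a ha
      refine inf_eq_left.mp ((hN.le_iff.mp (inf_le_left : N ⊓ F ≤ N)).resolve_left fun hb => ?_)
      have hx : a * (r * e) ∈ N ⊓ F := ⟨N.smul_mem (MulOpposite.op (r * e)) haN,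
        TwoSidedIdeal.mul_mem_left _ _ _ (TwoSidedIdeal.mul_mem_left _ _ _ hmem)⟩
      rw [hb, Submodule.mem_bot] at hx
      rw [mul_assoc, mul_assoc, hx, mul_zero] at hsr
      exact he0 hsr.symm
    exact hF

end RingSocle

section PolynomialOperators

variable {K : Type u} [Field K] {n : ℕ}

theorem Yop_monomial (i : Fin n) (α : Fin n →₀ ℕ) :
    Yop K n i (monomial α 1) = if α i = 0 then 0 else monomial (α - Finsupp.single i 1) 1 := by
  have h := (basisMonomials (Fin n) K).constr_basis K (fun α : Fin n →₀ ℕ =>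
    if α i = 0 then 0 else monomial (α - Finsupp.single i 1) (1 : K)) α
  rwa [coe_basisMonomials] at h

theorem coeff_Yop (i : Fin n) (p : PolyAlg K n) (γ : Fin n →₀ ℕ) :
    coeff γ (Yop K n i p) = coeff (γ + Finsupp.single i 1) p := by
  suffices h : lcoeff K γ ∘ₗ Yop K n i = lcoeff K (γ + Finsupp.single i 1) from
    LinearMap.congr_fun h p
  refine (basisMonomials (Fin n) K).ext fun α => ?_
  simp only [coe_basisMonomials, LinearMap.comp_apply, Yop_monomial, lcoeff_apply, coeff_monomial]
  split_ifs with h0 h1 h1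
  · subst h1; simp at h0
  · simp
  · subst h1; simp
  · rw [coeff_monomial, if_neg]
    rintro rfl
    apply h1
    ext j
    by_cases hj : j = i
    · subst hj; simp; omega
    · simp [Finsupp.single_eq_of_ne hj]

/-- The product `(1-x_1y_1)⋯(1-x_ny_n)` generating `F_n`. -/
def eS (K : Type u) [Field K] (n : ℕ) : SnAlg K n :=
  (List.ofFn fun i => 1 - xS K n i * yS K n i).prod

theorem one_sub_xS_mul_yS_monomial (i : Fin n) (α : Fin n →₀ ℕ) :
    ((1 - xS K n i * yS K n i : SnAlg K n) : Module.End K (PolyAlg K n)) (monomial α 1) =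
      if α i = 0 then monomial α 1 else 0 := by
  change monomial α 1 - X i * Yop K n i (monomial α 1) = _
  rw [Yop_monomial]
  split_ifs with h
  · simp
  · rw [X, monomial_mul, one_mul, sub_eq_zero, add_tsub_cancel_of_le]
    simpa using Nat.one_le_iff_ne_zero.mpr h

theorem list_prod_one_sub_xS_mul_yS_monomial (l : List (Fin n)) (α : Fin n →₀ ℕ) :
    (((l.map fun i => 1 - xS K n i * yS K n i).prod : SnAlg K n) :
      Module.End K (PolyAlg K n)) (monomial α 1) =
      if ∀ i ∈ l, α i = 0 then monomial α 1 else 0 := by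
  induction l with
  | nil => simp
  | cons i l ih =>
    rw [List.map_cons, List.prod_cons, MulMemClass.coe_mul, Module.End.mul_apply, ih]
    by_cases hl : ∀ j ∈ l, α j = 0
    · rw [if_pos hl, one_sub_xS_mul_yS_monomial]
      simp [and_iff_left hl]
    · rw [if_neg hl, map_zero, if_neg]
      exact fun h => hl fun j hj => h j (List.mem_cons_of_mem _ hj)

theorem eS_apply (p : PolyAlg K n) :
    (eS K n : Module.End K (PolyAlg K n)) p = monomial 0 (coeff 0 p) := by
  suffices h : (eS K n : Module.End K (PolyAlg K n)) = monomial 0 ∘ₗ lcoeff K 0 from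
    LinearMap.congr_fun h p
  refine (basisMonomials (Fin n) K).ext fun α => ?_
  rw [coe_basisMonomials, eS, List.ofFn_eq_map, list_prod_one_sub_xS_mul_yS_monomial]
  have hα : (∀ i ∈ List.finRange n, α i = 0) ↔ α = 0 := by
    simp [Finsupp.ext_iff]
  simp only [hα, LinearMap.comp_apply, lcoeff_apply, coeff_monomial]
  split_ifs with h
  · rw [h]
  · rw [map_zero]

theorem exists_SnAlg_coeff_add (β : Fin n →₀ ℕ) :
    ∃ s : SnAlg K n, ∀ (p : PolyAlg K n) (γ : Fin n →₀ ℕ),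
      coeff γ ((s : Module.End K (PolyAlg K n)) p) = coeff (γ + β) p := by
  induction β using Finsupp.induction_linear with
  | zero => exact ⟨1, fun p γ => by simp⟩
  | add f g hf hg =>
    obtain ⟨s, hs⟩ := hf
    obtain ⟨t, ht⟩ := hg
    refine ⟨s * t, fun p γ => ?_⟩
    rw [MulMemClass.coe_mul, Module.End.mul_apply, hs, ht, add_assoc]
  | single i m =>
    induction m with
    | zero => exact ⟨1, fun p γ => by simp⟩
    | succ m ih =>
      obtain ⟨s, hs⟩ := ih
      refine ⟨s * yS K n i, fun p γ => ?_⟩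
      rw [MulMemClass.coe_mul, Module.End.mul_apply, hs, Finsupp.single_add, ← add_assoc]
      exact coeff_Yop _ _ _

theorem exists_SnAlg_apply_eq_mul (p : PolyAlg K n) :
    ∃ r : SnAlg K n, ∀ q : PolyAlg K n, (r : Module.End K (PolyAlg K n)) q = p * q := by
  induction p using MvPolynomial.induction_on with
  | C a => exact ⟨a • 1, fun q => by simp [C_mul']⟩
  | add f g hf hg =>
    obtain ⟨s, hs⟩ := hf
    obtain ⟨t, ht⟩ := hg
    exact ⟨s + t, fun q => by simp [hs, ht, add_mul]⟩
  | mul_X f i hf =>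
    obtain ⟨s, hs⟩ := hf
    refine ⟨s * xS K n i, fun q => ?_⟩
    rw [MulMemClass.coe_mul, Module.End.mul_apply, hs, mul_assoc]
    rfl

theorem eS_mul_mul_eS (a : SnAlg K n) :
    eS K n * a * eS K n = coeff 0 ((a : Module.End K (PolyAlg K n)) 1) • eS K n := by
  refine Subtype.ext (LinearMap.ext fun p => ?_)
  have hp : (monomial 0 (coeff 0 p) : PolyAlg K n) = coeff 0 p • 1 := by
    rw [← C_apply, C_eq_smul_one]
  rw [MulMemClass.coe_mul, MulMemClass.coe_mul, Module.End.mul_apply, Module.End.mul_apply,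
    SetLike.val_smul, LinearMap.smul_apply, eS_apply, eS_apply, hp, map_smul, coeff_smul,
    smul_eq_mul, mul_comm, ← smul_eq_mul, ← smul_monomial, hp]

theorem eS_mul_self : eS K n * eS K n = eS K n := by
  simpa using eS_mul_mul_eS (1 : SnAlg K n)

theorem eS_ne_zero : eS K n ≠ 0 := by
  intro h
  have h1 := eS_apply (K := K) (n := n) 1
  rw [h] at h1
  simp at h1

theorem eS_corner_comm (a b : SnAlg K n) :
    eS K n * a * eS K n * (eS K n * b * eS K n) =
      eS K n * b * eS K n * (eS K n * a * eS K n) := by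
  rw [eS_mul_mul_eS, eS_mul_mul_eS, smul_mul_smul_comm, smul_mul_smul_comm, mul_comm (coeff _ _)]

theorem exists_eS_sandwich (a : SnAlg K n) (ha : a ≠ 0) :
    ∃ s r, eS K n * s * a * r * eS K n = eS K n := by
  obtain ⟨α, hα⟩ : ∃ α : Fin n →₀ ℕ,
      (a : Module.End K (PolyAlg K n)) (monomial α 1) ≠ 0 := by
    by_contra! hc
    refine ha (Subtype.ext ((basisMonomials (Fin n) K).ext fun α => ?_))
    rw [coe_basisMonomials, hc]
    rfl
  obtain ⟨β, hβ⟩ := MvPolynomial.ne_zero_iff.mp hα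
  obtain ⟨s, hs⟩ := exists_SnAlg_coeff_add (K := K) β
  obtain ⟨r, hr⟩ := exists_SnAlg_apply_eq_mul (K := K) (monomial α 1)
  set c := coeff β ((a : Module.End K (PolyAlg K n)) (monomial α 1)) with hc
  have key : eS K n * s * a * r * eS K n = c • eS K n := by
    rw [mul_assoc (eS K n), mul_assoc (eS K n), eS_mul_mul_eS, MulMemClass.coe_mul,
      MulMemClass.coe_mul, Module.End.mul_apply, Module.End.mul_apply, hr, hs, mul_one, zero_add]
  refine ⟨c⁻¹ • s, r, ?_⟩
  rw [mul_smul_comm, smul_mul_assoc, smul_mul_assoc, smul_mul_assoc, key, inv_smul_smul₀ hβ]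

end PolynomialOperators

/-- `F_n` is nonzero and contained in every nonzero two-sided ideal of `S_n`
(so it is the smallest nonzero ideal), `F_n² = F_n`, and `F_n` is the socle (the sum of all
simple submodules, i.e. the supremum of all atoms of the submodule lattice) of `S_n` both as a
left `S_n`-module and as a right `S_n`-module. -/
theorem statement1 (K : Type u) [Field K] (n : ℕ) (hn : 0 < n) :
    FIdeal K n ≠ ⊥ ∧
    (∀ I : TwoSidedIdeal (SnAlg K n), I ≠ ⊥ → FIdeal K n ≤ I) ∧
    tsiMul (FIdeal K n) (FIdeal K n) = FIdeal K n ∧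
    (FIdeal K n : Set (SnAlg K n)) =
      ((sSup {N : Submodule (SnAlg K n) (SnAlg K n) | IsAtom N} :
        Submodule (SnAlg K n) (SnAlg K n)) : Set (SnAlg K n)) ∧
    (FIdeal K n : Set (SnAlg K n)) =
      ((sSup {N : Submodule (SnAlg K n)ᵐᵒᵖ (SnAlg K n) | IsAtom N} :
        Submodule (SnAlg K n)ᵐᵒᵖ (SnAlg K n)) : Set (SnAlg K n)) := by
  exact ⟨fun h => eS_ne_zero ((TwoSidedIdeal.mem_bot _).mp
      (h.le (TwoSidedIdeal.subset_span rfl : eS K n ∈ FIdeal K n))),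
    fun I hI => TwoSidedIdeal.span_le.mpr (Set.singleton_subset_iff.mpr
      (TwoSidedIdeal.mem_of_forall_sandwich exists_eS_sandwich hI)),
    tsiMul_span_idempotent eS_mul_self,
    TwoSidedIdeal.coe_span_singleton_eq_left_socle exists_eS_sandwich eS_corner_comm
      eS_mul_self eS_ne_zero,
    TwoSidedIdeal.coe_span_singleton_eq_right_socle exists_eS_sandwich eS_corner_comm
      eS_mul_self eS_ne_zero⟩
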